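/- Let a and y be distinct coprime integers and let p ≥ 3 be a prime. Set S = ∑_{i=0}^{p−1} a^{p−1−i} y^i (so that y^p − a^p = (y−a)·S). Then: (1) gcd(y−a, S) equals 1 or p; (2) p divides y−a if and only if p divides S, and in that case S ≡ p (mod p²) if p ∤ a, while S ≡ 0 (mod p²) if p ∣ a; (3) if q is a prime with q ≠ p and q ∣ S, then q ≡ 1 (mod p). -/

import Mathlib

theorem lemma1 (a y : ℤ) (hay : a ≠ y) (hcop : IsCoprime a y)
    (p : ℕ) (hp : p.Prime) (hp3 : 3 ≤ p)
    (S : ℤ) (hS : S = ∑ i ∈ Finset.range p, a ^ (p - 1 - i) * y ^ i) :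
    (Int.gcd (y - a) S = 1 ∨ Int.gcd (y - a) S = p) ∧
    ((p : ℤ) ∣ (y - a) ↔ (p : ℤ) ∣ S) ∧
    ((p : ℤ) ∣ (y - a) →
      (¬ (p : ℤ) ∣ a → S ≡ (p : ℤ) [ZMOD ((p : ℤ) ^ 2)]) ∧
      ((p : ℤ) ∣ a → S ≡ 0 [ZMOD ((p : ℤ) ^ 2)])) ∧
    (∀ q : ℕ, q.Prime → q ≠ p → (q : ℤ) ∣ S → q ≡ 1 [MOD p]) := by
  have : Fact p.Prime := ⟨hp⟩
  have hS' : S = ∑ i ∈ Finset.range p, y ^ i * a ^ (p - 1 - i) := by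
    rw [hS]; exact Finset.sum_congr rfl fun i _ => mul_comm _ _
  have hmul : S * (y - a) = y ^ p - a ^ p := by
    rw [hS']; exact (Commute.all y a).geom_sum₂_mul p
  -- S is congruent to p a^(p-1) modulo y - a
  have hmod : (y - a) ∣ S - p * a ^ (p - 1) := by
    have h1 : (p : ℤ) * a ^ (p - 1) = ∑ i ∈ Finset.range p, a ^ i * a ^ (p - 1 - i) := by
      rw [Finset.sum_congr rfl (g := fun _ => a ^ (p - 1))]
      · simp
      · intro i hi
        rw [← pow_add]
        congr 1
        have := Finset.mem_range.mp hi
        omega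
    rw [h1, hS', ← Finset.sum_sub_distrib]
    refine Finset.dvd_sum fun i _ => ?_
    rw [← sub_mul]
    exact Dvd.dvd.mul_right (sub_dvd_pow_sub_pow y a i) _
  have hcop' : IsCoprime (y - a) a := by
    obtain ⟨u, v, h⟩ := hcop
    exact ⟨v, u + v, by linear_combination h⟩
  refine ⟨?_, ⟨?_, ?_⟩, ?_, ?_⟩
  · rw [← Nat.dvd_prime hp]
    have h1 : ((Int.gcd (y - a) S : ℕ) : ℤ) ∣ y - a := Int.gcd_dvd_left ..
    have h2 : ((Int.gcd (y - a) S : ℕ) : ℤ) ∣ S := Int.gcd_dvd_right ..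
    have h3 : ((Int.gcd (y - a) S : ℕ) : ℤ) ∣ p * a ^ (p - 1) := by
      have := dvd_sub h2 (h1.trans hmod)
      simpa using this
    have h4 := (hcop'.of_isCoprime_of_dvd_left h1).pow_right (n := p - 1)
    exact_mod_cast h4.dvd_of_dvd_mul_right h3
  · intro h
    have h1 := dvd_add (h.trans hmod) (Dvd.intro _ rfl : (p : ℤ) ∣ p * a ^ (p - 1))
    simpa using h1
  · intro h
    have h1 : (p : ℤ) ∣ y ^ p - a ^ p := hmul ▸ h.mul_right _
    rw [← ZMod.intCast_zmod_eq_zero_iff_dvd] at h1 ⊢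
    push_cast at h1 ⊢
    simpa [ZMod.pow_card] using h1
  · intro h
    refine ⟨fun ha => ?_, fun ha => ?_⟩
    · obtain ⟨k, hk⟩ := h
      have hodd : Odd p := hp.odd_of_ne_two (by omega)
      have h1 := odd_sq_dvd_geom_sum₂_sub (a := a) k hodd
      rw [show a + p * k = y by linarith, ← hS'] at h1
      have h2 : a ^ (p - 1) ≡ 1 [ZMOD p] :=
        Int.ModEq.pow_card_sub_one_eq_one hp
          (((Nat.prime_iff_prime_int.mp hp).coprime_iff_not_dvd.mpr ha).symm)
      have h3 : (p : ℤ) ^ 2 ∣ p * (a ^ (p - 1) - 1) := by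
        rw [pow_two]; exact mul_dvd_mul_left _ h2.symm.dvd
      refine (Int.modEq_iff_dvd.mpr ?_).symm
      have h4 := dvd_add h1 h3
      rwa [show S - p * a ^ (p - 1) + p * (a ^ (p - 1) - 1) = S - p by ring] at h4
    · exact absurd (hcop'.isUnit_of_dvd' h ha) (Nat.prime_iff_prime_int.mp hp).not_isUnit
  · intro q hq hqp hqS
    have : Fact q.Prime := ⟨hq⟩
    have h1 : (q : ℤ) ∣ y ^ p - a ^ p := hmul ▸ hqS.mul_right _
    have hqi := Nat.prime_iff_prime_int.mp hq
    have hqa : ¬ (q : ℤ) ∣ a := by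
      intro ha
      have h2 : (q : ℤ) ∣ y ^ p := by
        have := dvd_add h1 (dvd_pow ha hp.ne_zero)
        simpa using this
      exact hqi.not_isUnit (hcop.isUnit_of_dvd' ha (hqi.dvd_of_dvd_pow h2))
    have hne : ¬ (q : ℤ) ∣ y - a := by
      intro h
      have h2 : (q : ℤ) ∣ p * a ^ (p - 1) := by
        have := dvd_sub hqS (h.trans hmod)
        simpa using this
      rcases hqi.dvd_or_dvd h2 with h3 | h3
      · exact hqp ((Nat.prime_dvd_prime_iff_eq hq hp).mp (by exact_mod_cast h3))
      · exact hqa (hqi.dvd_of_dvd_pow h3)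
    rw [← ZMod.intCast_zmod_eq_zero_iff_dvd] at h1 hqa hne
    push_cast at h1 hne
    have hz : ((y : ZMod q) / a) ^ p = 1 := by
      rw [div_pow, sub_eq_zero.mp h1, div_self (pow_ne_zero _ hqa)]
    have hz1 : (y : ZMod q) / a ≠ 1 := by
      intro h
      rw [div_eq_one_iff_eq hqa] at h
      exact hne (sub_eq_zero.mpr h)
    have hz0 : (y : ZMod q) / a ≠ 0 := by
      intro h
      rw [h, zero_pow hp.ne_zero] at hz
      exact zero_ne_one hz
    have ho := orderOf_eq_prime hz hz1
    have hd := orderOf_dvd_of_pow_eq_one (ZMod.pow_card_sub_one_eq_one hz0)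
    rw [ho] at hd
    exact ((Nat.modEq_iff_dvd' hq.one_le).mpr hd).symm
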